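/- arXiv:2104.11283 — 2 statements merged into one kernel-verified Lean document; each statement's English description precedes it below -/
import Mathlib

section
/- Fix x ∈ ℝ^d, ξ ∈ Θ, δ > 0, and any index subset Ŝ ⊆ {1,…,d}. Then E_u[ ‖ ( (f(x + δu, ξ) − f(x, ξ))/δ − uᵀ∇f(x,ξ) ) · u_Ŝ ‖² ] ≤ (L² δ² / 4) d³, where u_Ŝ is the subvector of u indexed by Ŝ. -/
open scoped BigOperators RealInnerProductSpace

/-- The random sign vector `u ∈ {−1,1}^d` encoded by a boolean vector. -/
noncomputable def signVec (d : ℕ) (u : Fin d → Bool) : EuclideanSpace ℝ (Fin d) :=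
  (WithLp.equiv 2 (Fin d → ℝ)).symm (fun i => if u i then (1 : ℝ) else -1)

theorem signVec_apply_sq (d : ℕ) (u : Fin d → Bool) (i : Fin d) : signVec d u i ^ 2 = 1 := by
  by_cases hi : u i <;> simp [signVec, hi]

theorem norm_signVec_sq (d : ℕ) (u : Fin d → Bool) : ‖signVec d u‖ ^ 2 = d := by
  simp [EuclideanSpace.norm_sq_eq, signVec_apply_sq]

/-- The quadratic upper and lower bounds for a function with Lipschitz gradient. -/
theorem abs_sub_sub_inner_le_of_lipschitz_gradient {E : Type*} [NormedAddCommGroup E]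
    [InnerProductSpace ℝ E] [CompleteSpace E] {g : E → ℝ} {g' : E → E} {L : ℝ}
    (hg : ∀ x, HasGradientAt g (g' x) x) (hlip : ∀ x y, ‖g' x - g' y‖ ≤ L * ‖x - y‖) (x v : E) :
    |g (x + v) - g x - ⟪v, g' x⟫| ≤ L / 2 * ‖v‖ ^ 2 := by
  have hφ : ∀ t : ℝ, HasDerivAt (fun t : ℝ => g (x + t • v) - g x - t * ⟪v, g' x⟫)
      ⟪g' (x + t • v) - g' x, v⟫ t := fun t => by
    have hline : HasDerivAt (fun t : ℝ => x + t • v) v t := by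
      simpa using ((hasDerivAt_id t).smul_const v).const_add x
    have h := (((hg (x + t • v)).hasFDerivAt.comp_hasDerivAt t hline).sub_const (g x)).sub
      ((hasDerivAt_id t).mul_const ⟪v, g' x⟫)
    exact h.congr_deriv (by simp [inner_sub_left, real_inner_comm])
  have hB : ∀ t : ℝ, HasDerivAt (fun t : ℝ => L / 2 * ‖v‖ ^ 2 * t ^ 2) (L * ‖v‖ ^ 2 * t) t :=
    fun t => ((hasDerivAt_pow 2 t).const_mul (L / 2 * ‖v‖ ^ 2)).congr_deriv
      (by norm_num; ring)
  have h := image_norm_le_of_norm_deriv_right_le_deriv_boundary (a := 0) (b := 1)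
    (fun t _ => (hφ t).continuousAt.continuousWithinAt)
    (fun t _ => (hφ t).hasDerivWithinAt) (by simp) hB
    (fun t ht => ?_) (Set.right_mem_Icc.2 zero_le_one)
  · simpa using h
  · calc ‖⟪g' (x + t • v) - g' x, v⟫‖ ≤ ‖g' (x + t • v) - g' x‖ * ‖v‖ := norm_inner_le_norm _ _
      _ ≤ L * ‖x + t • v - x‖ * ‖v‖ := by gcongr; exact hlip _ _
      _ = L * ‖v‖ ^ 2 * t := by
        rw [add_sub_cancel_left, norm_smul, Real.norm_of_nonneg ht.1]
        ring

/-- If `f(·,ξ)` is differentiable with `L`-Lipschitz gradient, then for any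
`x ∈ ℝ^d`, `ξ ∈ Θ`, `δ > 0` and index set `Ŝ ⊆ {1,…,d}`,
`E_u[‖((f(x+δu,ξ) − f(x,ξ))/δ − uᵀ∇f(x,ξ)) · u_Ŝ‖²] ≤ (L²δ²/4) d³`,
where `u_Ŝ` is the subvector of `u` indexed by `Ŝ` (so the squared norm is the sum over
`i ∈ Ŝ` of squared components). -/
theorem stmt_5 {d : ℕ} {Θ : Type*}
    (f : EuclideanSpace ℝ (Fin d) → Θ → ℝ)
    (f' : EuclideanSpace ℝ (Fin d) → Θ → EuclideanSpace ℝ (Fin d)) (L : ℝ)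
    (hgrad : ∀ (ξ : Θ) (x : EuclideanSpace ℝ (Fin d)),
      HasGradientAt (fun y => f y ξ) (f' x ξ) x)
    (hlip : ∀ (ξ : Θ) (x₁ x₂ : EuclideanSpace ℝ (Fin d)),
      ‖f' x₁ ξ - f' x₂ ξ‖ ≤ L * ‖x₁ - x₂‖)
    (x : EuclideanSpace ℝ (Fin d)) (ξ : Θ) (δ : ℝ) (hδ : 0 < δ)
    (S : Finset (Fin d)) :
    (∑ u : Fin d → Bool,
        ∑ i ∈ S,
          (((f (x + δ • signVec d u) ξ - f x ξ) / δ - ⟪signVec d u, f' x ξ⟫)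
            * signVec d u i) ^ 2) / 2 ^ d
      ≤ L ^ 2 * δ ^ 2 / 4 * (d : ℝ) ^ 3 := by
  have hbound : ∀ u : Fin d → Bool,
      ((f (x + δ • signVec d u) ξ - f x ξ) / δ - ⟪signVec d u, f' x ξ⟫) ^ 2
        ≤ L ^ 2 * δ ^ 2 / 4 * (d : ℝ) ^ 2 := fun u => by
    have h := abs_sub_sub_inner_le_of_lipschitz_gradient (hgrad ξ) (hlip ξ) x (δ • signVec d u)
    rw [norm_smul, mul_pow, norm_signVec_sq, Real.norm_of_nonneg hδ.le,
      real_inner_smul_left] at h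
    have hdiv : |(f (x + δ • signVec d u) ξ - f x ξ) / δ - ⟪signVec d u, f' x ξ⟫|
        ≤ L * δ / 2 * d := by
      rw [div_sub' hδ.ne', abs_div, abs_of_pos hδ, div_le_iff₀ hδ]
      exact h.trans_eq (by ring)
    calc _ ≤ (L * δ / 2 * d) ^ 2 := sq_le_sq.2 (hdiv.trans (le_abs_self _))
      _ = _ := by ring
  rw [div_le_iff₀ (by positivity)]
  calc _ ≤ ∑ _u : Fin d → Bool, L ^ 2 * δ ^ 2 / 4 * (d : ℝ) ^ 3 := by
        refine Finset.sum_le_sum fun u _ => ?_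
        simp only [mul_pow, signVec_apply_sq, mul_one, Finset.sum_const, nsmul_eq_mul]
        have hcard : (S.card : ℝ) ≤ d := by
          exact_mod_cast (Finset.card_le_univ S).trans_eq (Fintype.card_fin d)
        calc _ ≤ (d : ℝ) * (L ^ 2 * δ ^ 2 / 4 * (d : ℝ) ^ 2) := by
              gcongr
              exact hbound u
          _ = _ := by ring
    _ = _ := by simp [mul_comm]
end

section
/- Fix x ∈ ℝ^d and an index subset Ŝ ⊆ {1,…,d}. Let u be a random sign vector with iid entries uniform on {−1,1} independent of ξ. Then E[ ‖ ∇_Ŝ F(x) − u_Ŝ u_Ŝᵀ ∇_Ŝ f(x,ξ) ‖² ] ≤ (|Ŝ| − 1) ‖∇_Ŝ F(x)‖² + |Ŝ| · E[ ‖∇_Ŝ f(x,ξ) − ∇_Ŝ F(x)‖² ]. -/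
open MeasureTheory
open scoped BigOperators

theorem signVec_apply (d : ℕ) (u : Fin d → Bool) (i : Fin d) :
    signVec d u i = if u i then (1 : ℝ) else -1 := rfl

theorem signVec_mul_self (d : ℕ) (u : Fin d → Bool) (i : Fin d) :
    signVec d u i * signVec d u i = 1 := by
  rw [signVec_apply]
  split_ifs <;> norm_num

/-- The coordinates of a uniform random sign vector are orthonormal. -/
theorem sum_signVec_mul_signVec (d : ℕ) (i j : Fin d) :
    ∑ u : Fin d → Bool, signVec d u i * signVec d u j = if i = j then (2 : ℝ) ^ d else 0 := by
  split_ifs with h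
  · subst h
    simp [signVec_mul_self]
  · refine Finset.sum_involution (fun u _ => Function.update u i (!u i)) ?_ ?_ ?_ ?_
    · intro u _
      simp only [signVec_apply, Function.update_self, Function.update_of_ne (Ne.symm h)]
      cases u i <;> cases u j <;> norm_num
    · intro u _ _ hu
      have := congrFun hu i
      simp at this
    · simp
    · simp

theorem sum_signVec_mul_inner (d : ℕ) (S : Finset (Fin d)) (g : Fin d → ℝ) {i : Fin d}
    (hi : i ∈ S) :
    ∑ u : Fin d → Bool, signVec d u i * ∑ j ∈ S, signVec d u j * g j = 2 ^ d * g i := by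
  simp_rw [Finset.mul_sum, ← mul_assoc]
  rw [Finset.sum_comm]
  simp_rw [← Finset.sum_mul, sum_signVec_mul_signVec]
  simp [hi]

theorem sum_signVec_inner_sq (d : ℕ) (S : Finset (Fin d)) (g : Fin d → ℝ) :
    ∑ u : Fin d → Bool, (∑ j ∈ S, signVec d u j * g j) ^ 2 = 2 ^ d * ∑ j ∈ S, g j ^ 2 := by
  simp_rw [pow_two (∑ j ∈ S, _), Finset.sum_mul (s := S)]
  rw [Finset.sum_comm, Finset.mul_sum]
  refine Finset.sum_congr rfl fun i hi => ?_
  simp_rw [mul_right_comm _ (g i), ← Finset.sum_mul]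
  rw [sum_signVec_mul_inner d S g hi]
  ring

/-- The sign average of the squared error, in terms of the deviation of `g` from `F`. -/
theorem sum_signVec_error_sq (d : ℕ) (S : Finset (Fin d)) (F g : Fin d → ℝ) :
    ∑ u : Fin d → Bool, ∑ i ∈ S,
        (F i - signVec d u i * ∑ j ∈ S, signVec d u j * g j) ^ 2
      = 2 ^ d * (((S.card : ℝ) - 1) * ∑ i ∈ S, F i ^ 2
        + (2 * (S.card : ℝ) - 2) * ∑ i ∈ S, F i * (g i - F i)
        + (S.card : ℝ) * ∑ i ∈ S, (g i - F i) ^ 2) := by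
  have expand (u : Fin d → Bool) (i : Fin d) (s : ℝ) :
      (F i - signVec d u i * s) ^ 2 = F i ^ 2 - 2 * F i * (signVec d u i * s) + s ^ 2 := by
    linear_combination s ^ 2 * signVec_mul_self d u i
  have coord : ∀ i ∈ S, ∑ u : Fin d → Bool,
      (F i - signVec d u i * ∑ j ∈ S, signVec d u j * g j) ^ 2
        = 2 ^ d * (-F i ^ 2 - 2 * (F i * (g i - F i)) + ∑ j ∈ S, g j ^ 2) := by
    intro i hi
    simp_rw [expand, Finset.sum_add_distrib, Finset.sum_sub_distrib, ← Finset.mul_sum]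
    rw [sum_signVec_mul_inner d S g hi, sum_signVec_inner_sq]
    simp only [Finset.sum_const, Finset.card_univ, Fintype.card_fun, Fintype.card_bool,
      Fintype.card_fin, nsmul_eq_mul]
    push_cast
    ring
  have split : ∑ j ∈ S, g j ^ 2 = ∑ i ∈ S, F i ^ 2 + 2 * ∑ i ∈ S, F i * (g i - F i)
      + ∑ i ∈ S, (g i - F i) ^ 2 := by
    rw [Finset.mul_sum, ← Finset.sum_add_distrib, ← Finset.sum_add_distrib]
    exact Finset.sum_congr rfl fun i _ => by ring
  rw [Finset.sum_comm, Finset.sum_congr rfl coord, ← Finset.mul_sum, split]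
  simp only [Finset.sum_add_distrib, Finset.sum_sub_distrib, Finset.sum_neg_distrib,
    ← Finset.mul_sum, Finset.sum_const, nsmul_eq_mul]
  ring

/-- Let `F(x) = E[f(x,ξ)]` with `∇F(x) = E[∇f(x,ξ)]` and finite gradient
variance, and let `u` be a uniform random sign vector independent of `ξ`. Then
`E[‖∇_Ŝ F(x) − u_Ŝ u_Ŝᵀ ∇_Ŝ f(x,ξ)‖²]
  ≤ (|Ŝ| − 1)‖∇_Ŝ F(x)‖² + |Ŝ| E[‖∇_Ŝ f(x,ξ) − ∇_Ŝ F(x)‖²]`,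
where the expectation over `(u,ξ)` is the uniform average over sign vectors of the
integral over `ξ`. -/
theorem stmt_6 {d : ℕ} {Ω : Type*} [MeasurableSpace Ω]
    (μ : Measure Ω) [IsProbabilityMeasure μ]
    (f' : EuclideanSpace ℝ (Fin d) → Ω → EuclideanSpace ℝ (Fin d))
    (x : EuclideanSpace ℝ (Fin d)) (Fg : EuclideanSpace ℝ (Fin d))
    (hint : Integrable (fun ω => f' x ω) μ)
    (hFg : Fg = ∫ ω, f' x ω ∂μ)
    (hvar : Integrable (fun ω => ‖f' x ω - Fg‖ ^ 2) μ)
    (S : Finset (Fin d)) :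
    (∑ u : Fin d → Bool,
        ∫ ω, ∑ i ∈ S,
          (Fg i - signVec d u i * ∑ j ∈ S, signVec d u j * f' x ω j) ^ 2 ∂μ) / 2 ^ d
      ≤ ((S.card : ℝ) - 1) * (∑ i ∈ S, (Fg i) ^ 2)
        + (S.card : ℝ) * ∫ ω, ∑ i ∈ S, (f' x ω i - Fg i) ^ 2 ∂μ := by
  have coord_int (i : Fin d) : Integrable (fun ω => f' x ω i) μ :=
    (EuclideanSpace.proj (𝕜 := ℝ) i).integrable_comp hint
  have dev_int (i : Fin d) : Integrable (fun ω => f' x ω i - Fg i) μ :=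
    (coord_int i).sub (integrable_const _)
  have dev_sq_int (i : Fin d) : Integrable (fun ω => (f' x ω i - Fg i) ^ 2) μ := by
    refine hvar.mono ((dev_int i).aestronglyMeasurable.pow 2) (.of_forall fun ω => ?_)
    rw [norm_pow, norm_pow, norm_norm]
    gcongr
    exact PiLp.norm_apply_le (f' x ω - Fg) i
  have coord_memLp (i : Fin d) : MemLp (fun ω => f' x ω i) 2 μ := by
    have dev_memLp : MemLp (fun ω => f' x ω i - Fg i) 2 μ :=
      (memLp_two_iff_integrable_sq (dev_int i).aestronglyMeasurable).2 (dev_sq_int i)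
    exact (dev_memLp.add (memLp_const (Fg i))).ae_eq (.of_forall fun ω => sub_add_cancel _ _)
  have dev_mean (i : Fin d) : ∫ ω, (f' x ω i - Fg i) ∂μ = 0 := by
    have mean : ∫ ω, f' x ω i ∂μ = Fg i := by
      rw [hFg]
      exact (EuclideanSpace.proj (𝕜 := ℝ) i).integral_comp_comm hint
    rw [integral_sub (coord_int i) (integrable_const _), mean]
    simp
  have error_int (u : Fin d → Bool) : Integrable (fun ω => ∑ i ∈ S,
      (Fg i - signVec d u i * ∑ j ∈ S, signVec d u j * f' x ω j) ^ 2) μ := by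
    refine integrable_finsetSum _ fun i _ => MemLp.integrable_sq ?_
    exact (memLp_const (Fg i)).sub
      ((memLp_finsetSum S fun j _ => (coord_memLp j).const_mul (signVec d u j)).const_mul _)
  have cross_int : Integrable (fun ω => ∑ i ∈ S, Fg i * (f' x ω i - Fg i)) μ :=
    integrable_finsetSum _ fun i _ => (dev_int i).const_mul _
  have cross_mean : ∫ ω, ∑ i ∈ S, Fg i * (f' x ω i - Fg i) ∂μ = 0 := by
    rw [integral_finsetSum _ fun i _ => (dev_int i).const_mul _]
    simp [integral_const_mul, dev_mean]
  have sq_int : Integrable (fun ω => ∑ i ∈ S, (f' x ω i - Fg i) ^ 2) μ :=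
    integrable_finsetSum _ fun i _ => dev_sq_int i
  have affine_int : Integrable (fun ω => ((S.card : ℝ) - 1) * ∑ i ∈ S, Fg i ^ 2
      + (2 * (S.card : ℝ) - 2) * ∑ i ∈ S, Fg i * (f' x ω i - Fg i)) μ :=
    (integrable_const _).add (cross_int.const_mul _)
  rw [← integral_finsetSum _ fun u _ => error_int u]
  simp_rw [sum_signVec_error_sq d S (fun i => Fg i) (fun i => f' x _ i)]
  rw [integral_const_mul, mul_div_cancel_left₀ _ (by positivity),
    integral_add affine_int (sq_int.const_mul _),
    integral_add (integrable_const _) (cross_int.const_mul _),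
    integral_const, integral_const_mul, integral_const_mul, cross_mean]
  simp
end
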